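/- Let E be a real inner product space and f : E → ℝ a convex differentiable function whose gradient is L-Lipschitz, i.e., ‖∇f(x) − ∇f(y)‖ ≤ L·‖x − y‖ for all x, y ∈ E, where L > 0. Then for all x, y ∈ E: f(x) − f(y) ≥ ⟪∇f(y), x − y⟫ + (1/(2L))·‖∇f(x) − ∇f(y)‖². -/

import Mathlib

open scoped RealInnerProductSpace

theorem aux_line {E : Type*} [NormedAddCommGroup E] [InnerProductSpace ℝ E] [CompleteSpace E]
    (f : E → ℝ) (hdiff : ∀ x, HasGradientAt f (gradient f x) x) (x v : E) (t : ℝ) :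
    HasDerivAt (fun s : ℝ => f (x + s • v)) (inner ℝ (gradient f (x + t • v)) v) t := by
  have h1 : HasDerivAt (fun s : ℝ => x + s • v) v t := by
    simpa using ((hasDerivAt_id t).smul_const v).const_add x
  have h2 := (hdiff (x + t • v)).hasFDerivAt.comp_hasDerivAt t h1
  simpa [Function.comp_def] using h2

theorem aux_convex {E : Type*} [NormedAddCommGroup E] [InnerProductSpace ℝ E] [CompleteSpace E]
    (f : E → ℝ) (hconv : ConvexOn ℝ Set.univ f)
    (hdiff : ∀ x, HasGradientAt f (gradient f x) x) (x v : E) :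
    f x + inner ℝ (gradient f x) v ≤ f (x + v) := by
  have hc : ConvexOn ℝ Set.univ (fun s : ℝ => f (x + s • v)) := by
    refine ⟨convex_univ, fun a _ b _ p q hp hq hpq => ?_⟩
    have h := hconv.2 (Set.mem_univ (x + a • v)) (Set.mem_univ (x + b • v)) hp hq hpq
    have e : p • (x + a • v) + q • (x + b • v) = x + (p • a + q • b) • v := by
      have : x = (p + q) • x := by rw [hpq, one_smul]
      conv_rhs => rw [this]
      simp only [smul_eq_mul]
      module
    rw [e] at h
    exact h
  have h := hc.le_slope_of_hasDerivAt (Set.mem_univ 0) (Set.mem_univ 1) zero_lt_one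
    (aux_line f hdiff x v 0)
  simp [slope_def_field] at h ⊢
  linarith

theorem aux_descent {E : Type*} [NormedAddCommGroup E] [InnerProductSpace ℝ E] [CompleteSpace E]
    (f : E → ℝ) (L : ℝ)
    (hdiff : ∀ x, HasGradientAt f (gradient f x) x)
    (hlip : ∀ x y : E, ‖gradient f x - gradient f y‖ ≤ L * ‖x - y‖) (x v : E) :
    f (x + v) ≤ f x + inner ℝ (gradient f x) v + L / 2 * ‖v‖ ^ 2 := by
  have hd : ∀ t : ℝ, HasDerivAt
      (fun s : ℝ => f (x + s • v) - s * inner ℝ (gradient f x) v - s ^ 2 * (L / 2 * ‖v‖ ^ 2))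
      (inner ℝ (gradient f (x + t • v)) v - inner ℝ (gradient f x) v - t * (L * ‖v‖ ^ 2)) t := by
    intro t
    have h := ((aux_line f hdiff x v t).sub
      ((hasDerivAt_id t).mul_const (inner ℝ (gradient f x) v))).sub
      (((hasDerivAt_id t).pow 2).mul_const (L / 2 * ‖v‖ ^ 2))
    refine h.congr_deriv ?_
    simp
    ring
  have ha := antitoneOn_of_deriv_nonpos (convex_Icc (0 : ℝ) 1)
    (fun t _ => (hd t).continuousAt.continuousWithinAt)
    (fun t _ => (hd t).differentiableAt.differentiableWithinAt)
    (fun t ht => by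
      rw [(hd t).deriv]
      rw [interior_Icc] at ht
      have h1 := real_inner_le_norm (gradient f (x + t • v) - gradient f x) v
      have h2 := hlip (x + t • v) x
      rw [add_sub_cancel_left, norm_smul, Real.norm_eq_abs, abs_of_pos ht.1] at h2
      rw [inner_sub_left] at h1
      have h3 := mul_le_mul_of_nonneg_right h2 (norm_nonneg v)
      nlinarith)
  have h := ha (Set.left_mem_Icc.2 zero_le_one) (Set.right_mem_Icc.2 zero_le_one) zero_le_one
  simp at h ⊢
  linarith

/-- Lemma 2 (Nesterov, Thm 2.1.5): for a convex differentiable function with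
`L`-Lipschitz gradient, `f x − f y ≥ ⟪∇f y, x − y⟫ + ‖∇f x − ∇f y‖² / (2L)`. -/
theorem convex_lipschitz_gradient_lower_bound
    {E : Type*} [NormedAddCommGroup E] [InnerProductSpace ℝ E] [CompleteSpace E]
    (f : E → ℝ) (L : ℝ) (hL : 0 < L)
    (hconv : ConvexOn ℝ Set.univ f)
    (hdiff : ∀ x, HasGradientAt f (gradient f x) x)
    (hlip : ∀ x y : E, ‖gradient f x - gradient f y‖ ≤ L * ‖x - y‖) :
    ∀ x y : E,
      f x - f y ≥ ⟪gradient f y, x - y⟫ + (1 / (2 * L)) * ‖gradient f x - gradient f y‖ ^ 2 := by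
  intro x y
  set d := gradient f x - gradient f y with hd
  have h1 := aux_convex f hconv hdiff y (x - y + (-(1 / L)) • d)
  have h2 := aux_descent f L hdiff hlip x ((-(1 / L)) • d)
  have e : y + (x - y + (-(1 / L)) • d) = x + (-(1 / L)) • d := by abel
  rw [e, inner_add_right, inner_smul_right] at h1
  rw [inner_smul_right, norm_smul, mul_pow, Real.norm_eq_abs, sq_abs] at h2
  have h3 : inner ℝ (gradient f x) d - inner ℝ (gradient f y) d = ‖d‖ ^ 2 := by
    rw [← inner_sub_left, ← hd, real_inner_self_eq_norm_sq]
  have h4 : L / 2 * ((-(1 / L)) ^ 2 * ‖d‖ ^ 2) = 1 / (2 * L) * ‖d‖ ^ 2 := by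
    field_simp
  have h5 : (1 / L) * (inner ℝ (gradient f x) d - inner ℝ (gradient f y) d)
      = 2 * (1 / (2 * L) * ‖d‖ ^ 2) := by
    rw [h3]; field_simp
  rw [h4] at h2
  linarith
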